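/- Let Ω ⊆ ℝ^N be Lebesgue measurable with |Ω| < ∞ and suppose D := dim_B(∞,Ω) exists and 𝓜̲^D(∞,Ω) > 0. Then the distance zeta function at infinity diverges to +∞ at D from the right along the reals: ζ_{∞,Ω}(s;T) → +∞ as s → D⁺ with s real, for any fixed T > 0. -/

import Mathlib

open MeasureTheory Filter Set Complex Topology
open scoped ENNReal Real

noncomputable section

/-- The "tail" of `Ω` beyond radius `t`: the complement of the open Euclidean ball of
radius `t` centered at `0`, intersected with `Ω`. -/
def tailSet (N : ℕ) (Ω : Set (EuclideanSpace ℝ (Fin N))) (t : ℝ) :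
    Set (EuclideanSpace ℝ (Fin N)) :=
  {x | x ∈ Ω ∧ t ≤ ‖x‖}

/-- The tube function `t ↦ |_tΩ|` at infinity. -/
def tubeVol (N : ℕ) (Ω : Set (EuclideanSpace ℝ (Fin N))) (t : ℝ) : ℝ :=
  (volume (tailSet N Ω t)).toReal

/-- Upper `r`-dimensional Minkowski content of `Ω` at infinity. -/
def upperMinkContent (N : ℕ) (Ω : Set (EuclideanSpace ℝ (Fin N))) (r : ℝ) : ℝ≥0∞ :=
  Filter.limsup (fun t : ℝ => volume (tailSet N Ω t) / ENNReal.ofReal (t ^ ((N : ℝ) + r)))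
    Filter.atTop

/-- Lower `r`-dimensional Minkowski content of `Ω` at infinity. -/
def lowerMinkContent (N : ℕ) (Ω : Set (EuclideanSpace ℝ (Fin N))) (r : ℝ) : ℝ≥0∞ :=
  Filter.liminf (fun t : ℝ => volume (tailSet N Ω t) / ENNReal.ofReal (t ^ ((N : ℝ) + r)))
    Filter.atTop

/-- Upper Minkowski dimension of `Ω` at infinity. -/
def upperMinkDim (N : ℕ) (Ω : Set (EuclideanSpace ℝ (Fin N))) : ℝ :=
  sInf {r : ℝ | upperMinkContent N Ω r = 0}

/-- Lower Minkowski dimension of `Ω` at infinity. -/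
def lowerMinkDim (N : ℕ) (Ω : Set (EuclideanSpace ℝ (Fin N))) : ℝ :=
  sInf {r : ℝ | lowerMinkContent N Ω r = 0}

/-- Distance (Lapidus) zeta function of `Ω` at infinity. -/
def distZeta (N : ℕ) (Ω : Set (EuclideanSpace ℝ (Fin N))) (T : ℝ) (s : ℂ) : ℂ :=
  ∫ x in tailSet N Ω T, (‖x‖ : ℂ) ^ (-s - (N : ℂ))

/-- Tube zeta function of `Ω` at infinity. -/
def tubeZeta (N : ℕ) (Ω : Set (EuclideanSpace ℝ (Fin N))) (T : ℝ) (s : ℂ) : ℂ :=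
  ∫ t in Set.Ioi T, (t : ℂ) ^ (-s - (N : ℂ) - 1) * ((tubeVol N Ω t : ℝ) : ℂ)

/-- Abscissa of (absolute) convergence of the distance zeta function at infinity. -/
def distAbscissa (N : ℕ) (Ω : Set (EuclideanSpace ℝ (Fin N))) (T : ℝ) : ℝ :=
  sInf {σ : ℝ | ∀ s : ℂ, σ < s.re →
    IntegrableOn (fun x => (‖x‖ : ℂ) ^ (-s - (N : ℂ))) (tailSet N Ω T) volume}

/-- Abscissa of (absolute) convergence of the tube zeta function at infinity. -/
def tubeAbscissa (N : ℕ) (Ω : Set (EuclideanSpace ℝ (Fin N))) (T : ℝ) : ℝ :=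
  sInf {σ : ℝ | ∀ s : ℂ, σ < s.re →
    IntegrableOn (fun t : ℝ => (t : ℂ) ^ (-s - (N : ℂ) - 1) * ((tubeVol N Ω t : ℝ) : ℂ))
      (Set.Ioi T) volume}

section PowerMoments

variable {α : Type*} [MeasurableSpace α] {μ : Measure α} {f : α → ℝ}

lemma tendsto_measure_setOf_le_atTop [IsFiniteMeasure μ] (hf : Measurable f) :
    Tendsto (fun t : ℝ => μ {x | t ≤ f x}) atTop (𝓝 0) := by
  have h := tendsto_measure_iInter_atTop (μ := μ) (s := fun t : ℝ => {x | t ≤ f x})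
    (fun t => (measurableSet_le measurable_const hf).nullMeasurableSet)
    (fun a b hab x (hx : b ≤ f x) => hab.trans hx) ⟨0, measure_ne_top _ _⟩
  have h_inter : ⋂ t : ℝ, {x | t ≤ f x} = ∅ := by
    refine eq_empty_of_forall_notMem fun x hx => ?_
    have h1 : f x + 1 ≤ f x := mem_iInter.1 hx (f x + 1)
    linarith
  simpa [h_inter, Function.comp_def] using h

/-- A power-law lower bound on the tail of `f` under a finite measure forces decay: `q` is
positive. -/
lemma pos_of_eventually_le_rpow_mul_measure [IsFiniteMeasure μ] (hf : Measurable f)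
    {q : ℝ} {c : ℝ≥0∞} (hc : c ≠ 0)
    (h : ∀ᶠ t : ℝ in atTop, c ≤ ENNReal.ofReal (t ^ q) * μ {x | t ≤ f x}) : 0 < q := by
  by_contra! hq
  refine hc (le_zero_iff.1 (ge_of_tendsto (tendsto_measure_setOf_le_atTop (μ := μ) hf) ?_))
  filter_upwards [h, eventually_ge_atTop 1] with t ht ht1
  refine ht.trans (mul_le_of_le_one_left zero_le ?_)
  exact ENNReal.ofReal_le_one.2 (Real.rpow_le_one_of_one_le_of_nonpos ht1 hq)

/-- A power-law lower bound of exponent `-q` on the tail of `f` makes its `q`-th moment infinite. -/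
lemma lintegral_rpow_eq_top_of_eventually_le [IsFiniteMeasure μ] (hf : Measurable f)
    {q : ℝ} {c : ℝ≥0∞} (hc : c ≠ 0)
    (h : ∀ᶠ t : ℝ in atTop, c ≤ ENNReal.ofReal (t ^ q) * μ {x | t ≤ f x}) :
    ∫⁻ x, ENNReal.ofReal (f x ^ q) ∂μ = ⊤ := by
  have hq := pos_of_eventually_le_rpow_mul_measure hf hc h
  by_contra hfin
  have : IsFiniteMeasure (μ.withDensity fun x => ENNReal.ofReal (f x ^ q)) :=
    isFiniteMeasure_withDensity hfin
  refine hc (le_zero_iff.1 (ge_of_tendsto (tendsto_measure_setOf_le_atTop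
    (μ := μ.withDensity fun x => ENNReal.ofReal (f x ^ q)) hf) ?_))
  filter_upwards [h, eventually_ge_atTop 0] with t ht ht0
  have hs : MeasurableSet {x | t ≤ f x} := measurableSet_le measurable_const hf
  rw [withDensity_apply _ hs]
  refine ht.trans ?_
  rw [← setLIntegral_const]
  exact setLIntegral_mono' hs fun x hx =>
    ENNReal.ofReal_le_ofReal (Real.rpow_le_rpow ht0 hx hq.le)

/-- A power-law upper bound of exponent `-q` on the tail of `f` makes its lower moments finite. -/
lemma lintegral_rpow_ne_top_of_eventually_le [IsFiniteMeasure μ] (hf : Measurable f)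
    (hf0 : ∀ x, 0 ≤ f x) {p q : ℝ} (hp : 0 < p) (hpq : p < q)
    (h : ∀ᶠ t : ℝ in atTop, μ {x | t ≤ f x} ≤ ENNReal.ofReal (t ^ (-q))) :
    ∫⁻ x, ENNReal.ofReal (f x ^ p) ∂μ ≠ ⊤ := by
  obtain ⟨K, hK⟩ := eventually_atTop.1 (h.and (eventually_gt_atTop 0))
  have hK0 : 0 < K := (hK K le_rfl).2
  rw [lintegral_rpow_eq_lintegral_meas_le_mul μ (Eventually.of_forall hf0) hf.aemeasurable hp,
    ← Ioc_union_Ioi_eq_Ioi hK0.le]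
  refine ENNReal.mul_ne_top ENNReal.ofReal_ne_top
    (ne_top_of_le_ne_top (ENNReal.add_ne_top.2 ⟨?_, ?_⟩) (lintegral_union_le _ _ _))
  · have hint : IntegrableOn (fun t : ℝ => t ^ (p - 1)) (Ioc 0 K) :=
      (intervalIntegrable_iff_integrableOn_Ioc_of_le hK0.le).1
        (intervalIntegral.intervalIntegrable_rpow' (by linarith))
    refine ne_top_of_le_ne_top (ENNReal.mul_ne_top (measure_ne_top μ univ)
      hint.lintegral_lt_top.ne) ?_
    rw [← lintegral_const_mul' _ _ (measure_ne_top μ univ)]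
    exact lintegral_mono fun t => mul_le_mul_left (measure_mono (subset_univ _)) _
  · have hint : IntegrableOn (fun t : ℝ => t ^ (-q + (p - 1))) (Ioi K) :=
      integrableOn_Ioi_rpow_of_lt (by linarith) hK0
    refine ne_top_of_le_ne_top hint.lintegral_lt_top.ne
      (setLIntegral_mono' measurableSet_Ioi fun t ht => ?_)
    obtain ⟨h1, h2⟩ := hK t (le_of_lt ht)
    rw [Real.rpow_add h2, ENNReal.ofReal_mul (Real.rpow_nonneg h2.le _)]
    exact mul_le_mul_left h1 _

lemma tendsto_lintegral_rpow_nhds_top (hf : Measurable f) (hf0 : ∀ᵐ x ∂μ, 0 < f x)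
    {q : ℝ} (h : ∫⁻ x, ENNReal.ofReal (f x ^ q) ∂μ = ⊤) :
    Tendsto (fun p : ℝ => ∫⁻ x, ENNReal.ofReal (f x ^ p) ∂μ) (𝓝 q) (𝓝 ⊤) := by
  refine tendsto_of_le_liminf_of_limsup_le ?_ le_top
  rw [← h]
  refine le_trans (le_of_eq (lintegral_congr_ae ?_))
    (lintegral_liminf_le fun p => (hf.pow_const p).ennreal_ofReal)
  filter_upwards [hf0] with x hx
  refine (Tendsto.liminf_eq ?_).symm
  exact (ENNReal.continuous_ofReal.tendsto _).comp
    (Real.continuousAt_const_rpow hx.ne').tendsto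

end PowerMoments

section MinkowskiAtInfinity

variable {N : ℕ} {Ω : Set (EuclideanSpace ℝ (Fin N))}

lemma measurableSet_tailSet (hΩ : MeasurableSet Ω) (t : ℝ) : MeasurableSet (tailSet N Ω t) :=
  hΩ.inter (measurableSet_le measurable_const measurable_norm)

lemma restrict_tailSet_apply {T t : ℝ} (hTt : T ≤ t) :
    (volume.restrict (tailSet N Ω T)) {x | t ≤ ‖x‖} = volume (tailSet N Ω t) := by
  rw [Measure.restrict_apply (measurableSet_le measurable_const measurable_norm)]
  congr 1
  ext x
  exact ⟨fun h => ⟨h.2.1, h.1⟩, fun h => ⟨h.2, h.1, hTt.trans h.2⟩⟩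

/-- A set of finite volume has vanishing upper Minkowski content in dimension `1 - N`. -/
lemma upperMinkContent_one_sub_eq_zero (hfin : volume Ω ≠ ⊤) :
    upperMinkContent N Ω (1 - N) = 0 := by
  have h : Tendsto (fun t : ℝ => volume Ω / ENNReal.ofReal t) atTop (𝓝 0) := by
    have := ENNReal.Tendsto.const_div (a := volume Ω) ENNReal.tendsto_ofReal_atTop (Or.inr hfin)
    simpa using this
  refine (tendsto_of_tendsto_of_tendsto_of_le_of_le tendsto_const_nhds h
    (fun _ => zero_le) fun t => ?_).limsup_eq
  have hexp : (N : ℝ) + (1 - N) = 1 := by ring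
  simp only [hexp, Real.rpow_one]
  exact ENNReal.div_le_div_right (measure_mono fun x hx => hx.1) _

lemma eventually_volume_tailSet_le {r : ℝ} (h : upperMinkContent N Ω r = 0) :
    ∀ᶠ t : ℝ in atTop, volume (tailSet N Ω t) ≤ ENNReal.ofReal (t ^ ((N : ℝ) + r)) := by
  have h1 := eventually_lt_of_limsup_lt (show upperMinkContent N Ω r < 1 by simp [h])
  filter_upwards [h1, eventually_gt_atTop 0] with t ht ht0
  have hpos : ENNReal.ofReal (t ^ ((N : ℝ) + r)) ≠ 0 := by
    simpa using Real.rpow_pos_of_pos ht0 _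
  simpa using (ENNReal.div_le_iff hpos ENNReal.ofReal_ne_top).1 ht.le

lemma exists_eventually_le_volume_tailSet {r : ℝ} (h : 0 < lowerMinkContent N Ω r) :
    ∃ c : ℝ≥0∞, c ≠ 0 ∧ ∀ᶠ t : ℝ in atTop,
      c ≤ ENNReal.ofReal (t ^ (-r - N)) * volume (tailSet N Ω t) := by
  obtain ⟨c, hc0, hc⟩ := exists_between h
  refine ⟨c, hc0.ne', ?_⟩
  filter_upwards [eventually_lt_of_lt_liminf hc, eventually_gt_atTop 0] with t ht ht0
  refine ht.le.trans_eq ?_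
  rw [ENNReal.div_eq_inv_mul, ← ENNReal.ofReal_inv_of_pos (Real.rpow_pos_of_pos ht0 _),
    ← Real.rpow_neg ht0.le, show -((N : ℝ) + r) = -r - N by ring]

/-- At real points the distance zeta function is a moment of the norm over a tail of `Ω`. -/
lemma re_distZeta_ofReal (T s : ℝ) :
    (distZeta N Ω T (s : ℂ)).re =
      (∫⁻ x in tailSet N Ω T, ENNReal.ofReal (‖x‖ ^ (-s - N))).toReal := by
  have h : ∀ x : EuclideanSpace ℝ (Fin N),
      (‖x‖ : ℂ) ^ (-(s : ℂ) - (N : ℂ)) = ((‖x‖ ^ (-s - N) : ℝ) : ℂ) := fun x => by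
    rw [Complex.ofReal_cpow (norm_nonneg x)]
    push_cast
    rfl
  simp only [distZeta, h]
  rw [integral_complex_ofReal, Complex.ofReal_re, integral_eq_lintegral_of_nonneg_ae
    (Eventually.of_forall fun x => Real.rpow_nonneg (norm_nonneg x) _)
    (measurable_norm.pow_const _).aestronglyMeasurable]

end MinkowskiAtInfinity

/-- if `D = dim_B(∞,Ω)` exists and the lower `D`-dimensional Minkowski
content at infinity is positive, then `ζ_{∞,Ω}(s;T) → +∞` as `s → D⁺` along the reals. -/
theorem distance_zeta_blows_up_at_dimension
    (N : ℕ) (Ω : Set (EuclideanSpace ℝ (Fin N)))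
    (hmeas : MeasurableSet Ω) (hfin : volume Ω < ⊤)
    (T : ℝ) (hT : 0 < T)
    (D : ℝ) (hdimlow : lowerMinkDim N Ω = D) (hdimup : upperMinkDim N Ω = D)
    (hlow : 0 < lowerMinkContent N Ω D) :
    Tendsto (fun s : ℝ => (distZeta N Ω T (s : ℂ)).re) (𝓝[>] D) atTop := by
  have hTfin : volume (tailSet N Ω T) < ⊤ := (measure_mono fun x hx => hx.1).trans_lt hfin
  have : IsFiniteMeasure (volume.restrict (tailSet N Ω T)) := ⟨by simpa using hTfin⟩
  obtain ⟨c, hc0, hc⟩ := exists_eventually_le_volume_tailSet hlow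
  replace hc : ∀ᶠ t : ℝ in atTop, c ≤ ENNReal.ofReal (t ^ (-D - N)) *
      (volume.restrict (tailSet N Ω T)) {x | t ≤ ‖x‖} := by
    filter_upwards [hc, eventually_ge_atTop T] with t ht hTt
    rwa [restrict_tailSet_apply hTt]
  have hD : 0 < -D - (N : ℝ) := pos_of_eventually_le_rpow_mul_measure measurable_norm hc0 hc
  have hnorm_pos : ∀ᵐ x ∂volume.restrict (tailSet N Ω T), 0 < ‖x‖ :=
    (ae_restrict_mem (measurableSet_tailSet hmeas T)).mono fun x hx => hT.trans_le hx.2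
  have hcont : Tendsto (fun s : ℝ => -s - (N : ℝ)) (𝓝[>] D) (𝓝 (-D - N)) :=
    (Continuous.tendsto (by fun_prop) D).mono_left nhdsWithin_le_nhds
  have hlim := (tendsto_lintegral_rpow_nhds_top measurable_norm hnorm_pos
    (lintegral_rpow_eq_top_of_eventually_le measurable_norm hc0 hc)).comp hcont
  have hne_top : ∀ᶠ s : ℝ in 𝓝[>] D,
      ∫⁻ x in tailSet N Ω T, ENNReal.ofReal (‖x‖ ^ (-s - (N : ℝ))) ≠ ⊤ := by
    filter_upwards [self_mem_nhdsWithin, hcont.eventually_const_lt hD] with s hs hs0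
    obtain ⟨r, hr, hrs⟩ := exists_lt_of_csInf_lt
      (s := {r : ℝ | upperMinkContent N Ω r = 0}) ⟨_, upperMinkContent_one_sub_eq_zero hfin.ne⟩ (hdimup.trans_lt hs)
    refine lintegral_rpow_ne_top_of_eventually_le measurable_norm norm_nonneg hs0
      (sub_lt_sub_right (neg_lt_neg hrs) _) ?_
    filter_upwards [eventually_volume_tailSet_le hr, eventually_ge_atTop T] with t ht hTt
    rwa [restrict_tailSet_apply hTt, show -(-r - (N : ℝ)) = N + r by ring]
  refine tendsto_atTop.2 fun b => ?_
  filter_upwards [hne_top, hlim.eventually_const_lt (ENNReal.ofReal_lt_top (r := b))] with s hs hb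
  rw [re_distZeta_ofReal]
  exact (ENNReal.ofReal_le_iff_le_toReal hs).1 hb.le
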